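/- Under the hypotheses below (dynamical Yang–Baxter equation for the three R-matrices and generic invertibility of 𝓡_{12}), the two transfer matrices with quantum space W_3 commute: T_1 T_2 = T_2 T_1 as difference operators on W_3[0]-valued meromorphic functions of λ ∈ ℂ^N. -/

import Mathlib

open scoped BigOperators
open Complex Matrix Filter Topology

noncomputable section

namespace EllipticQG

/-- Jacobi's first theta function `θ(z) = -∑_{j ∈ ℤ+1/2} e^{πij²τ + 2πij(z+1/2)}`. -/
def theta (τ z : ℂ) : ℂ :=
  -∑' j : ℤ, Complex.exp ((Real.pi : ℂ) * Complex.I * ((j : ℂ) + 1 / 2) ^ 2 * τ +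
      2 * (Real.pi : ℂ) * Complex.I * ((j : ℂ) + 1 / 2) * (z + 1 / 2))

/-- `α(z,μ) = θ(z)θ(μ+γ)/(θ(z-γ)θ(μ))`. -/
def alphaF (τ γ z μ : ℂ) : ℂ :=
  theta τ z * theta τ (μ + γ) / (theta τ (z - γ) * theta τ μ)

/-- `β(z,μ) = -θ(z+μ)θ(γ)/(θ(z-γ)θ(μ))`. -/
def betaF (τ γ z μ : ℂ) : ℂ :=
  -(theta τ (z + μ) * theta τ γ) / (theta τ (z - γ) * theta τ μ)

/-- The elliptic dynamical R-matrix of `E_{τ,γ/2}(gl_N)` on `ℂ^N ⊗ ℂ^N`.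
Entry `((i,j),(k,l))` is the coefficient of `e_i ⊗ e_j` in `R (e_k ⊗ e_l)`. -/
def Rmat (N : ℕ) (τ γ z : ℂ) (lam : Fin N → ℂ) :
    Matrix (Fin N × Fin N) (Fin N × Fin N) ℂ := fun p q =>
  if p.1 = p.2 then (if q = p then 1 else 0)
  else (if q = p then alphaF τ γ z (lam p.1 - lam p.2) else 0) +
    (if q = (p.2, p.1) then betaF τ γ z (lam p.1 - lam p.2) else 0)

/-- `λ - γ ∑_{c ∈ S} h^{(c)}` evaluated on the configuration `g` of basis indices. -/
def shiftL {n N : ℕ} (γ : ℂ) (lam : Fin N → ℂ) (S : Finset (Fin n)) (g : Fin n → Fin N) :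
    Fin N → ℂ :=
  fun i => lam i - γ * ((S.filter fun c => g c = i).card : ℂ)

/-- `R(z, λ - γ ∑_{c∈S} h^{(c)})^{(a b)}` acting on `(ℂ^N)^{⊗ n}`. -/
def Rop (N n : ℕ) (τ γ z : ℂ) (lam : Fin N → ℂ) (S : Finset (Fin n)) (a b : Fin n) :
    Matrix (Fin n → Fin N) (Fin n → Fin N) ℂ := fun f g =>
  if ∀ c, c ≠ a → c ≠ b → f c = g c then
    Rmat N τ γ z (shiftL γ lam S g) (f a, f b) (g a, g b)
  else 0

/-- The operators `W_n(z,λ)`, defined recursively:  `W_1 = 1` and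
`W_{n+1}(z,λ) = R(z_1-z_2, λ-γ∑_{j=3}^{n+1}h^{(j)})^{(12)} ⋯ R(z_1-z_{n+1},λ)^{(1 n+1)}
  (1 ⊗ W_n(z_2,…,z_{n+1}, λ-γh^{(1)}))` (tensor factors indexed `0,…,n`). -/
def Wrec (N : ℕ) (τ γ : ℂ) : (n : ℕ) → (Fin n → ℂ) → (Fin N → ℂ) →
    Matrix (Fin n → Fin N) (Fin n → Fin N) ℂ
  | 0, _, _ => 1
  | n + 1, z, lam =>
    (((List.finRange n).map fun j : Fin n =>
      Rop N (n + 1) τ γ (z 0 - z j.succ) lam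
        (Finset.univ.filter fun c : Fin (n + 1) => j.succ < c) 0 j.succ).prod) *
      Matrix.of (fun f g : Fin (n + 1) → Fin N =>
        if f 0 = g 0 then
          Wrec N τ γ n (fun j => z j.succ) (fun i => lam i - if g 0 = i then γ else 0)
            (Fin.tail f) (Fin.tail g)
        else 0)

/-- `W^S_n(λ) = W_n(z^S, λ)` with `z^S = (0, γ, 2γ, …, (n-1)γ)`. -/
def WS (N n : ℕ) (τ γ : ℂ) (lam : Fin N → ℂ) :
    Matrix (Fin n → Fin N) (Fin n → Fin N) ℂ :=
  Wrec N τ γ n (fun j => ((j : ℕ) : ℂ) * γ) lam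

/-- `z^∧ = ((n-1)γ, …, 2γ, γ, 0)`. -/
def zWedge (n : ℕ) (γ : ℂ) : Fin n → ℂ := fun j => ((n - 1 - (j : ℕ) : ℕ) : ℂ) * γ

/-- `W^∧_n(λ) = lim_{z → z^∧} ∏_{j=1}^{n-1} (z_j - z_{j+1} - γ) · ρ W_n(z,λ) ρ`,
where `ρ` reverses the order of the tensor factors. -/
def Wwedge (N n : ℕ) (τ γ : ℂ) (lam : Fin N → ℂ) :
    Matrix (Fin n → Fin N) (Fin n → Fin N) ℂ :=
  limUnder (𝓝[≠] zWedge n γ) fun z : Fin n → ℂ =>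
    (∏ j : Fin n, if h : (j : ℕ) + 1 < n then z j - z ⟨(j : ℕ) + 1, h⟩ - γ else 1) •
      Matrix.of fun f g : Fin n → Fin N => Wrec N τ γ n z lam (f ∘ Fin.rev) (g ∘ Fin.rev)

/-- The space `S²(ℂ^N)` of symmetric tensors in `ℂ^N ⊗ ℂ^N`. -/
def symPair (N : ℕ) : Submodule ℂ ((Fin N × Fin N) → ℂ) where
  carrier := {v | ∀ p : Fin N × Fin N, v p = v (p.2, p.1)}
  add_mem' := by intro a b ha hb p; simp only [Pi.add_apply, ha p, hb p]
  zero_mem' := by intro p; rfl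
  smul_mem' := by intro c v hv p; simp only [Pi.smul_apply, hv p]

/-- `R^{reg}(γ,λ) = lim_{z→γ} (z-γ) R(z,λ)`. -/
def Rreg (N : ℕ) (τ γ : ℂ) (lam : Fin N → ℂ) : Matrix (Fin N × Fin N) (Fin N × Fin N) ℂ :=
  limUnder (𝓝[≠] γ) fun z : ℂ => (z - γ) • Rmat N τ γ z lam

/-- The flip `P : u ⊗ v ↦ v ⊗ u` on `ℂ^N ⊗ ℂ^N`. -/
def Pmat (N : ℕ) : Matrix (Fin N × Fin N) (Fin N × Fin N) ℂ := fun p q =>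
  if q = (p.2, p.1) then 1 else 0

/-- The space `S^n(ℂ^N)` of symmetric tensors in `(ℂ^N)^{⊗n}`. -/
def symTensors (N n : ℕ) : Submodule ℂ ((Fin n → Fin N) → ℂ) where
  carrier := {v | ∀ (σ : Equiv.Perm (Fin n)) (f : Fin n → Fin N), v (f ∘ σ) = v f}
  add_mem' := by intro a b ha hb σ f; simp only [Pi.add_apply, ha σ f, hb σ f]
  zero_mem' := by intro σ f; rfl
  smul_mem' := by intro c v hv σ f; simp only [Pi.smul_apply, hv σ f]

/-- `J_n(ℂ^N)`: the span of tensors `σ v - sign(σ) v`. -/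
def Jspan (N n : ℕ) : Submodule ℂ ((Fin n → Fin N) → ℂ) :=
  Submodule.span ℂ {w | ∃ (σ : Equiv.Perm (Fin n)) (v : (Fin n → Fin N) → ℂ),
    w = (fun f => v (f ∘ σ)) - ((Equiv.Perm.sign σ : ℤ) : ℂ) • v}

/-- `ℂ^N ⊗ W ⊆ ℂ^N ⊗ (ℂ^N)^{⊗ n}` for a subspace `W ⊆ (ℂ^N)^{⊗ n}`. -/
def consSlice (N n : ℕ) (W : Submodule ℂ ((Fin n → Fin N) → ℂ)) :
    Submodule ℂ ((Fin (n + 1) → Fin N) → ℂ) where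
  carrier := {v | ∀ i : Fin N, (fun g : Fin n → Fin N => v (Fin.cons i g)) ∈ W}
  add_mem' := by intro a b ha hb i; exact W.add_mem (ha i) (hb i)
  zero_mem' := by intro i; exact W.zero_mem
  smul_mem' := by intro c v hv i; exact W.smul_mem c (hv i)

/-- The `L`-operator of `V^{⊗n}(w)`:
`L(z,λ) = R(z-w, λ-γ∑_{j=2}^n h^{(j)})^{(01)} ⋯ R(z-w-γ(n-1), λ)^{(0n)}`,
acting on `ℂ^N ⊗ (ℂ^N)^{⊗n}` with factors numbered `0,…,n`. -/
def Lop (N n : ℕ) (τ γ z w : ℂ) (lam : Fin N → ℂ) :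
    Matrix (Fin (n + 1) → Fin N) (Fin (n + 1) → Fin N) ℂ :=
  ((List.finRange n).map fun j : Fin n =>
    Rop N (n + 1) τ γ (z - w - (j : ℕ) * γ) lam
      (Finset.univ.filter fun c : Fin (n + 1) => j.succ < c) 0 j.succ).prod

/-- The `L`-operator for the opposite coproduct:
`L'(z,λ) = R(z-w-γ(n-1), λ-γ∑_{j=1}^{n-1} h^{(j)})^{(0n)} ⋯ R(z-w, λ)^{(01)}`. -/
def Lop' (N n : ℕ) (τ γ z w : ℂ) (lam : Fin N → ℂ) :
    Matrix (Fin (n + 1) → Fin N) (Fin (n + 1) → Fin N) ℂ :=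
  (((List.finRange n).reverse).map fun j : Fin n =>
    Rop N (n + 1) τ γ (z - w - (j : ℕ) * γ) lam
      (Finset.univ.filter fun c : Fin (n + 1) => 0 < c ∧ c < j.succ) 0 j.succ).prod

/-- `Id ⊗ M` on `ℂ^N ⊗ (ℂ^N)^{⊗n}`. -/
def idTensor (N n : ℕ) (M : Matrix (Fin n → Fin N) (Fin n → Fin N) ℂ) :
    Matrix (Fin (n + 1) → Fin N) (Fin (n + 1) → Fin N) ℂ :=
  Matrix.of fun f g => if f 0 = g 0 then M (Fin.tail f) (Fin.tail g) else 0

/-- `Id ⊗ M(λ - γ h^{(0)})` on `ℂ^N ⊗ (ℂ^N)^{⊗n}`. -/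
def idTensorShift (N n : ℕ) (γ : ℂ)
    (M : (Fin N → ℂ) → Matrix (Fin n → Fin N) (Fin n → Fin N) ℂ) (lam : Fin N → ℂ) :
    Matrix (Fin (n + 1) → Fin N) (Fin (n + 1) → Fin N) ℂ :=
  Matrix.of fun f g =>
    if f 0 = g 0 then M (fun i => lam i - if g 0 = i then γ else 0) (Fin.tail f) (Fin.tail g)
    else 0

/-- The zero-weight symmetric tensor `e`: the sum of all `e_{i_1} ⊗ ⋯ ⊗ e_{i_n}` over
sequences in which each index occurs exactly `ℓ` times. -/
def evec (N n ℓ : ℕ) : (Fin n → Fin N) → ℂ := fun f =>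
  if ∀ i : Fin N, (Finset.univ.filter fun j => f j = i).card = ℓ then 1 else 0

/-- The multi-index of `ē = e_1^{⊗ℓ} ⊗ ⋯ ⊗ e_N^{⊗ℓ}`. -/
def barIdx (N ℓ : ℕ) : Fin (N * ℓ) → Fin N := fun j =>
  ⟨j.val / ℓ, by
    have h : (j : ℕ) < ℓ * N := by rw [Nat.mul_comm ℓ N]; exact j.isLt
    exact Nat.div_lt_of_lt_mul h⟩

/-- `g_{N,ℓ}(λ) = ∏_{1≤j<k≤N} ∏_{s=1}^ℓ θ(λ_j-λ_k+γs)/θ(λ_j-λ_k-γ(s-1))`. -/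
def gfun (N ℓ : ℕ) (τ γ : ℂ) (lam : Fin N → ℂ) : ℂ :=
  ∏ j : Fin N, ∏ k : Fin N,
    if j < k then
      ∏ s ∈ Finset.Icc 1 ℓ,
        theta τ (lam j - lam k + γ * (s : ℂ)) / theta τ (lam j - lam k - γ * ((s : ℂ) - 1))
    else 1

/-- The permutation induced by a word in the generators `s_1, …, s_n` of `S_{n+1}`:
`π_k = s_{a_1} ∘ ⋯ ∘ s_{a_k}` (letters `a` act as the transposition of `a` and `a+1`). -/
def permOfWord {n : ℕ} : List (Fin n) → Equiv.Perm (Fin (n + 1))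
  | [] => 1
  | a :: rest => Equiv.swap a.castSucc a.succ * permOfWord rest

/-- The product of R-matrices attached to a word (with accumulated permutation `π`):
`W_w(z,λ) = F_k ⋯ F_1` where for the `t`-th letter `a`
`F_t = R(z_{π(a)} - z_{π(a+1)}, λ - γ ∑_{b<a} h^{(π(b))})^{(π(a), π(a+1))}`,
`π = π_{t-1}` the permutation induced by the earlier letters. -/
def Wword (N : ℕ) {n : ℕ} (τ γ : ℂ) (z : Fin (n + 1) → ℂ) (lam : Fin N → ℂ) :
    List (Fin n) → Equiv.Perm (Fin (n + 1)) →
      Matrix (Fin (n + 1) → Fin N) (Fin (n + 1) → Fin N) ℂ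
  | [], _ => 1
  | a :: rest, π =>
      Wword N τ γ z lam rest (π * Equiv.swap a.castSucc a.succ) *
        Rop N (n + 1) τ γ (z (π a.castSucc) - z (π a.succ)) lam
          ((Finset.univ.filter fun c : Fin (n + 1) => (c : ℕ) < (a : ℕ)).image π)
          (π a.castSucc) (π a.succ)

/-- The fused R-matrix `𝓡_{V^{⊗m}(z), V^{⊗n}(w)}(λ)` on `(ℂ^N)^{⊗(m+n)}`
(first block: factors `0,…,m-1`; second block: factors `m,…,m+n-1`). -/
def Rmn (N m n : ℕ) (τ γ z w : ℂ) (lam : Fin N → ℂ) :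
    Matrix (Fin (m + n) → Fin N) (Fin (m + n) → Fin N) ℂ :=
  ((List.finRange m).map fun a : Fin m =>
    ((List.finRange n).map fun j : Fin n =>
      Rop N (m + n) τ γ (z + (a : ℕ) * γ - w - (j : ℕ) * γ) lam
        (Finset.univ.filter fun c : Fin (m + n) =>
          (c : ℕ) < (a : ℕ) ∨ m + (j : ℕ) < (c : ℕ))
        (Fin.castAdd n a) (Fin.natAdd m j)).prod).prod

/-- `A ⊗ B ⊆ (ℂ^N)^{⊗m} ⊗ (ℂ^N)^{⊗n}`, realised as `(A ⊗ V₂) ∩ (V₁ ⊗ B)`. -/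
def blockSub (N m n : ℕ) (A : Submodule ℂ ((Fin m → Fin N) → ℂ))
    (B : Submodule ℂ ((Fin n → Fin N) → ℂ)) :
    Submodule ℂ ((Fin (m + n) → Fin N) → ℂ) where
  carrier := {v |
    (∀ g : Fin n → Fin N, (fun f : Fin m → Fin N => v (Fin.append f g)) ∈ A) ∧
    ∀ f : Fin m → Fin N, (fun g : Fin n → Fin N => v (Fin.append f g)) ∈ B}
  add_mem' := by
    intro x y hx hy
    exact ⟨fun g => A.add_mem (hx.1 g) (hy.1 g), fun f => B.add_mem (hx.2 f) (hy.2 f)⟩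
  zero_mem' := ⟨fun _ => A.zero_mem, fun _ => B.zero_mem⟩
  smul_mem' := by
    intro c x hx
    exact ⟨fun g => A.smul_mem c (hx.1 g), fun f => B.smul_mem c (hx.2 f)⟩

/-- Matrix element `L_{jk}(z,λ)` of the `L`-operator (evaluation point `w = 0`),
as an operator on `(ℂ^N)^{⊗n}`: `L(z,λ)(e_k ⊗ v) = ∑_j e_j ⊗ L_{jk}(z,λ) v`. -/
def LmatEl (N n : ℕ) (τ γ z : ℂ) (lam : Fin N → ℂ) (j k : Fin N)
    (v : (Fin n → Fin N) → ℂ) : (Fin n → Fin N) → ℂ := fun g =>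
  (Lop N n τ γ z 0 lam).mulVec
    (fun f => (if f 0 = k then (1 : ℂ) else 0) * v (Fin.tail f)) (Fin.cons j g)

/-- `L_{j_{σ(1)} j_1}(z, λ-γ(ω_{j_2}+⋯+ω_{j_m})) ∘ ⋯ ∘ L_{j_{σ(m)} j_m}(z-(m-1)γ, λ)`. -/
def chainT (N n m : ℕ) (τ γ z : ℂ) (lam : Fin N → ℂ) (jt : Fin m → Fin N)
    (σ : Equiv.Perm (Fin m)) (v : (Fin n → Fin N) → ℂ) : (Fin n → Fin N) → ℂ :=
  (List.finRange m).foldr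
    (fun (t : Fin m) acc =>
      LmatEl N n τ γ (z - (t.val : ℂ) * γ)
        (fun i => lam i -
          γ * ((Finset.univ.filter fun s : Fin m => t < s ∧ jt s = i).card : ℂ))
        (jt (σ t)) (jt t) acc)
    v

/-- The transfer matrix `T_m(z)`, acting on scalar functions of `λ` via the identification
of the zero weight space of `S^{Nℓ}(ℂ^N)` with `ℂ` by the basis vector `e`:
`T_m(z) f(λ) = ∑_{j_1<⋯<j_m} ∑_{σ} (-1)^σ [L_{j_{σ(1)} j_1}(z,λ-γ(ω_{j_2}+⋯+ω_{j_m})) ⋯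
L_{j_{σ(m)} j_m}(z-(m-1)γ, λ)] e · f(λ-γ(ω_{j_1}+⋯+ω_{j_m}))`. -/
def Tm (N ℓ m : ℕ) (τ γ z : ℂ) (lam : Fin N → ℂ) (f : (Fin N → ℂ) → ℂ) : ℂ :=
  ∑ jt ∈ Finset.univ.filter fun jt : Fin m → Fin N => ∀ s t : Fin m, s < t → jt s < jt t,
    ∑ σ : Equiv.Perm (Fin m),
      ((Equiv.Perm.sign σ : ℤ) : ℂ) *
        chainT N (N * ℓ) m τ γ z lam jt σ (evec N (N * ℓ) ℓ) (barIdx N ℓ) *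
        f fun i => lam i - if ∃ t, jt t = i then γ else 0

/-- The `m`-th Ruijsenaars operator with coupling constant `ℓ`:
`M_m f(λ) = ∑_{|J|=m} ∏_{j∈J,k∉J} θ(λ_j-λ_k+ℓγ)/θ(λ_j-λ_k) · f(λ-γ∑_{j∈J}ω_j)`. -/
def Mm (N ℓ m : ℕ) (τ γ : ℂ) (f : (Fin N → ℂ) → ℂ) (lam : Fin N → ℂ) : ℂ :=
  ∑ J ∈ Finset.powersetCard m (Finset.univ : Finset (Fin N)),
    (∏ j ∈ J, ∏ k ∈ Jᶜ, theta τ (lam j - lam k + (ℓ : ℂ) * γ) / theta τ (lam j - lam k)) *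
      f fun i => lam i - if i ∈ J then γ else 0

/-- The transfer matrix with auxiliary space indexed by `ι` (weights `wt`) and quantum
space indexed by `ι₃`: `T f(λ) = ∑_μ tr_{W[μ]}(𝓡(λ)) f(λ-γμ)`. -/
def transferOp {N : ℕ} {ι ι₃ : Type} [Fintype ι] [Fintype ι₃] (γ : ℂ)
    (wt : ι → Fin N → ℂ) (R : (Fin N → ℂ) → Matrix (ι × ι₃) (ι × ι₃) ℂ)
    (f : (Fin N → ℂ) → ι₃ → ℂ) : (Fin N → ℂ) → ι₃ → ℂ := fun lam b =>
  ∑ a : ι, ∑ b' : ι₃, R lam (a, b) (a, b') * f (fun r => lam r - γ * wt a r) b'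


/-- If `R` intertwines `A` and `B` and is block diagonal for the fibres of `wt`, then the traces of
`A` and `B` weighted by a function of `wt` agree. -/
theorem sum_diag_mul_eq_of_intertwine {ι W : Type*} [Fintype ι] [DecidableEq ι]
    (wt : ι → W) {R A B : Matrix ι ι ℂ} (hR : IsUnit R)
    (hwt : ∀ p q, wt p ≠ wt q → R p q = 0) (hAB : R * A = B * R) (φ : W → ℂ) :
    ∑ p, A p p * φ (wt p) = ∑ p, B p p * φ (wt p) := by
  have htrace (M : Matrix ι ι ℂ) :
      ∑ p, M p p * φ (wt p) = (M * Matrix.diagonal fun p => φ (wt p)).trace := by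
    simp [Matrix.trace, Matrix.mul_diagonal]
  have hcomm : Commute R (Matrix.diagonal fun p => φ (wt p)) := by
    ext p q
    rw [Matrix.mul_diagonal, Matrix.diagonal_mul]
    by_cases h : wt p = wt q
    · rw [h, mul_comm]
    · simp [hwt p q h]
  obtain ⟨u, rfl⟩ := hR
  have hA : A = (↑u⁻¹ : Matrix ι ι ℂ) * (B * u) := by
    rw [← hAB, Units.inv_mul_cancel_left]
  rw [htrace, htrace, hA, mul_assoc, mul_assoc, hcomm.eq, Matrix.trace_mul_comm, mul_assoc,
    mul_assoc, Units.mul_inv, mul_one]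

/-- The composition of two transfer matrices, written as a sum over pairs of auxiliary indices. -/
theorem transferOp_transferOp_apply {N : ℕ} {ι κ ι₃ : Type} [Fintype ι] [Fintype κ] [Fintype ι₃]
    (γ : ℂ) (wt : ι → Fin N → ℂ) (wt' : κ → Fin N → ℂ)
    (R : (Fin N → ℂ) → Matrix (ι × ι₃) (ι × ι₃) ℂ) (R' : (Fin N → ℂ) → Matrix (κ × ι₃) (κ × ι₃) ℂ)
    (f : (Fin N → ℂ) → ι₃ → ℂ) (lam : Fin N → ℂ) (b : ι₃) :
    transferOp γ wt R (transferOp γ wt' R' f) lam b =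
      ∑ b', ∑ a, ∑ a', (∑ c, R lam (a, b) (a, c) *
        R' (fun r => lam r - γ * wt a r) (a', c) (a', b')) *
          f (fun r => lam r - γ * (wt a + wt' a') r) b' := by
  simp only [transferOp, Finset.mul_sum, Finset.sum_mul, Pi.add_apply, mul_add, sub_sub, mul_assoc]
  conv_rhs => rw [Finset.sum_comm]
  refine Finset.sum_congr rfl fun a _ => ?_
  rw [Finset.sum_comm]
  conv_rhs => rw [Finset.sum_comm]
  exact Finset.sum_congr rfl fun a' _ => Finset.sum_comm

/-- A transfer matrix preserves the functions supported on the zero weight space. -/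
theorem transferOp_apply_eq_zero {N : ℕ} {ι ι₃ : Type} [Fintype ι] [Fintype ι₃] (γ : ℂ)
    (wt : ι → Fin N → ℂ) (wt₃ : ι₃ → Fin N → ℂ)
    {R : (Fin N → ℂ) → Matrix (ι × ι₃) (ι × ι₃) ℂ}
    (hR : ∀ (lam : Fin N → ℂ) (p q : ι × ι₃),
      wt p.1 + wt₃ p.2 ≠ wt q.1 + wt₃ q.2 → R lam p q = 0)
    {f : (Fin N → ℂ) → ι₃ → ℂ} (hf : ∀ (lam : Fin N → ℂ) (b : ι₃), wt₃ b ≠ 0 → f lam b = 0)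
    (lam : Fin N → ℂ) (b : ι₃) (hb : wt₃ b ≠ 0) : transferOp γ wt R f lam b = 0 := by
  refine Finset.sum_eq_zero fun a _ => Finset.sum_eq_zero fun b' _ => ?_
  by_cases hb' : wt₃ b' = 0
  · rw [hR lam (a, b) (a, b') (by simpa [hb'] using hb), zero_mul]
  · rw [hf _ b' hb', mul_zero]

/-- commutativity of transfer matrices. The graded spaces `W_i` are
encoded by finite index types `ιᵢ` of homogeneous basis vectors with weights `wtᵢ`;
`W_3[0]`-valued functions are those vanishing on basis vectors of nonzero weight. -/
theorem transfer_matrices_commute (N : ℕ) (γ : ℂ) (ι₁ ι₂ ι₃ : Type)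
    [Fintype ι₁] [Fintype ι₂] [Fintype ι₃]
    [DecidableEq ι₁] [DecidableEq ι₂] [DecidableEq ι₃]
    (wt₁ : ι₁ → Fin N → ℂ) (wt₂ : ι₂ → Fin N → ℂ) (wt₃ : ι₃ → Fin N → ℂ)
    (R12 : (Fin N → ℂ) → Matrix (ι₁ × ι₂) (ι₁ × ι₂) ℂ)
    (R13 : (Fin N → ℂ) → Matrix (ι₁ × ι₃) (ι₁ × ι₃) ℂ)
    (R23 : (Fin N → ℂ) → Matrix (ι₂ × ι₃) (ι₂ × ι₃) ℂ)
    (hw12 : ∀ (lam : Fin N → ℂ) (p q : ι₁ × ι₂),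
      wt₁ p.1 + wt₂ p.2 ≠ wt₁ q.1 + wt₂ q.2 → R12 lam p q = 0)
    (hw13 : ∀ (lam : Fin N → ℂ) (p q : ι₁ × ι₃),
      wt₁ p.1 + wt₃ p.2 ≠ wt₁ q.1 + wt₃ q.2 → R13 lam p q = 0)
    (hw23 : ∀ (lam : Fin N → ℂ) (p q : ι₂ × ι₃),
      wt₂ p.1 + wt₃ p.2 ≠ wt₂ q.1 + wt₃ q.2 → R23 lam p q = 0)
    (hYBE : ∀ lam : Fin N → ℂ,
      (Matrix.of fun p q : ι₁ × ι₂ × ι₃ =>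
          if p.2.2 = q.2.2 then
            R12 (fun r => lam r - γ * wt₃ q.2.2 r) (p.1, p.2.1) (q.1, q.2.1)
          else 0) *
        (Matrix.of fun p q : ι₁ × ι₂ × ι₃ =>
          if p.2.1 = q.2.1 then R13 lam (p.1, p.2.2) (q.1, q.2.2) else 0) *
        (Matrix.of fun p q : ι₁ × ι₂ × ι₃ =>
          if p.1 = q.1 then
            R23 (fun r => lam r - γ * wt₁ q.1 r) (p.2.1, p.2.2) (q.2.1, q.2.2)
          else 0) =
      (Matrix.of fun p q : ι₁ × ι₂ × ι₃ =>
          if p.1 = q.1 then R23 lam (p.2.1, p.2.2) (q.2.1, q.2.2) else 0) *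
        (Matrix.of fun p q : ι₁ × ι₂ × ι₃ =>
          if p.2.1 = q.2.1 then
            R13 (fun r => lam r - γ * wt₂ q.2.1 r) (p.1, p.2.2) (q.1, q.2.2)
          else 0) *
        (Matrix.of fun p q : ι₁ × ι₂ × ι₃ =>
          if p.2.2 = q.2.2 then R12 lam (p.1, p.2.1) (q.1, q.2.1) else 0))
    (hinv : ∃ U : Set (Fin N → ℂ), IsOpen U ∧ Dense U ∧
      ∀ lam ∈ U, IsUnit (R12 lam)) :
    ∃ V : Set (Fin N → ℂ), IsOpen V ∧ Dense V ∧
      ∀ f : (Fin N → ℂ) → ι₃ → ℂ, (∀ (lam : Fin N → ℂ) (b : ι₃), wt₃ b ≠ 0 → f lam b = 0) →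
        ∀ lam ∈ V,
          transferOp γ wt₁ R13 (transferOp γ wt₂ R23 f) lam =
            transferOp γ wt₂ R23 (transferOp γ wt₁ R13 f) lam := by
  obtain ⟨U, hUo, hUd, hU⟩ := hinv
  refine ⟨U, hUo, hUd, fun f hf lam hlam => funext fun b => ?_⟩
  by_cases hb : wt₃ b = 0
  swap
  · rw [transferOp_apply_eq_zero γ wt₁ wt₃ hw13 (transferOp_apply_eq_zero γ wt₂ wt₃ hw23 hf) _ _ hb,
      transferOp_apply_eq_zero γ wt₂ wt₃ hw23 (transferOp_apply_eq_zero γ wt₁ wt₃ hw13 hf) _ _ hb]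
  rw [transferOp_transferOp_apply, transferOp_transferOp_apply]
  refine Finset.sum_congr rfl fun b' _ => ?_
  by_cases hb' : wt₃ b' = 0
  swap
  · simp [hf _ b' hb']
  have hAB : R12 lam * (Matrix.of fun p q : ι₁ × ι₂ => ∑ c, R13 lam (p.1, b) (q.1, c) *
        R23 (fun r => lam r - γ * wt₁ q.1 r) (p.2, c) (q.2, b')) =
      (Matrix.of fun p q : ι₁ × ι₂ => ∑ c, R23 lam (p.2, b) (q.2, c) *
        R13 (fun r => lam r - γ * wt₂ q.2 r) (p.1, c) (q.1, b')) * R12 lam := by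
    ext p q
    have h := congrFun (congrFun (hYBE lam) (p.1, p.2, b)) (q.1, q.2, b')
    rw [Matrix.mul_assoc] at h
    simpa [Matrix.mul_apply, Fintype.sum_prod_type, hb, hb'] using h
  have h := sum_diag_mul_eq_of_intertwine (fun p : ι₁ × ι₂ => wt₁ p.1 + wt₂ p.2) (hU lam hlam)
    (hw12 lam) hAB fun μ => f (fun r => lam r - γ * μ r) b'
  rw [Fintype.sum_prod_type, Fintype.sum_prod_type] at h
  conv_rhs => rw [Finset.sum_comm]
  simpa [add_comm] using h

end EllipticQG
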